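/- Suppose q ∈ B_{ℵ₀}. Then (0, 1/(q−1)) contains a q null infinite point. -/

import Mathlib

noncomputable section

open Set

/-- The map `T_{q,i}(x) = q*x - i` for a binary digit `i`. -/
def Tmap (q : ℝ) (i : Fin 2) (x : ℝ) : ℝ := q * x - ((i : ℕ) : ℝ)

/-- The value `((ε_i)_{i=1}^∞)_q = ∑_{i=1}^∞ ε_i q^{-i}` of a binary sequence in base `q`
(the sequence is 0-indexed, so digit `ε i` has weight `q^{-(i+1)}`). -/
def seqVal (q : ℝ) (ε : ℕ → Fin 2) : ℝ := ∑' i : ℕ, ((ε i : ℕ) : ℝ) / q ^ (i + 1)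

/-- `Σ_q(x)`: the set of `q`-expansions of `x`. -/
def SigmaSet (q x : ℝ) : Set (ℕ → Fin 2) := {ε | x = seqVal q ε}

/-- The interval `I_q = [0, 1/(q-1)]`. -/
def Iq (q : ℝ) : Set ℝ := Icc 0 (1 / (q - 1))

/-- The switch region `S_q = [1/q, 1/(q(q-1))]`. -/
def Sq (q : ℝ) : Set ℝ := Icc (1 / q) (1 / (q * (q - 1)))

/-- The interval `J_q = [(q+q²)/(q⁴-1), (1+q³)/(q⁴-1)]`. -/
def Jq (q : ℝ) : Set ℝ := Icc ((q + q ^ 2) / (q ^ 4 - 1)) ((1 + q ^ 3) / (q ^ 4 - 1))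

/-- Apply the first `n` maps of a sequence of maps to `x`:
`applySeq a n x = (a_{n-1} ∘ ⋯ ∘ a_0)(x)`. -/
def applySeq (a : ℕ → ℝ → ℝ) (n : ℕ) (x : ℝ) : ℝ := (List.range n).foldl (fun y k => a k y) x

/-- `Ω_q(x)`: the set of sequences of maps, each equal to `T_{q,0}` or `T_{q,1}`,
all of whose partial compositions applied to `x` stay in `I_q`. -/
def OmegaSet (q x : ℝ) : Set (ℕ → ℝ → ℝ) :=
  {a | (∀ n, a n = Tmap q 0 ∨ a n = Tmap q 1) ∧ ∀ n : ℕ, applySeq a (n + 1) x ∈ Iq q}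

/-- Apply a finite word of digits to `x` (first letter applied first):
for `a = [a₁, …, aₙ]`, `wordMap q a x = (T_{q,aₙ} ∘ ⋯ ∘ T_{q,a₁})(x)`. -/
def wordMap (q : ℝ) (a : List (Fin 2)) (x : ℝ) : ℝ := a.foldl (fun y i => Tmap q i y) x

/-- A branching sequence for `x`: a finite word whose partial compositions applied to `x`
stay in `I_q`, and whose full composition maps `x` into the switch region `S_q`. -/
def IsBranching (q x : ℝ) (a : List (Fin 2)) : Prop :=
  (∀ k, k ≤ a.length → wordMap q (a.take k) x ∈ Iq q) ∧ wordMap q a x ∈ Sq q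

/-- `x` is a `q` null infinite point: `x ∈ (0,1/(q-1))`, `Ω_q(x)` is infinite, and for every
branching sequence `a` for `x` there is a digit `i` with `Ω_q(T_{q,i}(a(x)))` finite. -/
def NullInfinite (q x : ℝ) : Prop :=
  x ∈ Ioo 0 (1 / (q - 1)) ∧ (OmegaSet q x).Infinite ∧
    ∀ a : List (Fin 2), IsBranching q x a →
      ∃ i : Fin 2, (OmegaSet q (Tmap q i (wordMap q a x))).Finite

/-- `U_q`: points of `I_q` with exactly one `q`-expansion. -/
def UniqSet (q : ℝ) : Set ℝ := {x | x ∈ Iq q ∧ ∃! ε : ℕ → Fin 2, ε ∈ SigmaSet q x}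

/-- `B_{ℵ₀}`: bases `q ∈ (1,2)` for which some `x ∈ (0,1/(q-1))` has exactly countably
infinitely many `q`-expansions. -/
def BAleph0 : Set ℝ :=
  {q | q ∈ Ioo (1 : ℝ) 2 ∧ ∃ x ∈ Ioo (0 : ℝ) (1 / (q - 1)),
    Cardinal.mk ↥(SigmaSet q x) = Cardinal.aleph0}

/-- The eventually periodic binary sequence `u w^∞`: the finite word `u` followed by
infinitely many repetitions of the finite word `w`. -/
def uwInf (u w : List (Fin 2)) : ℕ → Fin 2 := fun i =>
  if i < u.length then u.getD i 0 else w.getD ((i - u.length) % w.length) 0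

/-- Prepend the finite word `a` to the sequence `ε`. -/
def prependWord : List (Fin 2) → (ℕ → Fin 2) → ℕ → Fin 2
  | [], ε => ε
  | i :: a, ε => fun n => Nat.casesOn n i (prependWord a ε)

/-- The word formed by the first `n` letters of `ε`. -/
def initialWord : (ℕ → Fin 2) → ℕ → List (Fin 2)
  | _, 0 => []
  | ε, n + 1 => ε 0 :: initialWord (fun k => ε (k + 1)) n

theorem prependWord_append (a b : List (Fin 2)) (ε : ℕ → Fin 2) :
    prependWord (a ++ b) ε = prependWord a (prependWord b ε) := by
  induction a with
  | nil => rfl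
  | cons i a ih => simp only [List.cons_append, prependWord, ih]

theorem prependWord_injective (a : List (Fin 2)) : Function.Injective (prependWord a) := by
  induction a with
  | nil => exact fun _ _ h => h
  | cons i a ih => exact fun ε δ h => ih (funext fun n => congrFun h (n + 1))

theorem continuous_prependWord (a : List (Fin 2)) : Continuous (prependWord a) := by
  induction a with
  | nil => exact continuous_id
  | cons i a ih =>
    refine continuous_pi fun n => ?_
    cases n with
    | zero => exact continuous_const
    | succ n => exact (continuous_apply n).comp ih

theorem prependWord_initialWord (ε δ : ℕ → Fin 2) (n : ℕ) :
    ∀ k < n, prependWord (initialWord ε n) δ k = ε k := by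
  induction n generalizing ε with
  | zero => simp
  | succ n ih =>
    intro k hk
    cases k with
    | zero => rfl
    | succ k => exact ih (fun k => ε (k + 1)) k (by omega)

theorem exists_prependWord_initialWord {ε ζ : ℕ → Fin 2} {n : ℕ} (h : ∀ k < n, ζ k = ε k) :
    ∃ δ, prependWord (initialWord ε n) δ = ζ := by
  induction n generalizing ε ζ with
  | zero => exact ⟨ζ, rfl⟩
  | succ n ih =>
    obtain ⟨δ, hδ⟩ := ih (ε := fun k => ε (k + 1)) (ζ := fun k => ζ (k + 1))
      fun k hk => h (k + 1) (by omega)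
    refine ⟨δ, funext fun k => ?_⟩
    cases k with
    | zero => exact (h 0 (by omega)).symm
    | succ k => exact congrFun hδ k

theorem range_prependWord_initialWord (ε : ℕ → Fin 2) (n : ℕ) :
    range (prependWord (initialWord ε n)) = PiNat.cylinder ε n := by
  ext ζ
  rw [PiNat.mem_cylinder_iff]
  constructor
  · rintro ⟨δ, rfl⟩
    exact prependWord_initialWord ε δ n
  · exact exists_prependWord_initialWord

theorem exists_range_prependWord_subset {ε : ℕ → Fin 2} {U : Set (ℕ → Fin 2)} (hU : U ∈ nhds ε) :
    ∃ w, range (prependWord w) ∈ nhds ε ∧ range (prependWord w) ⊆ U := by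
  obtain ⟨V, ⟨δ, n, rfl⟩, hε, hV⟩ :=
    (PiNat.isTopologicalBasis_cylinders (fun _ : ℕ => Fin 2)).mem_nhds_iff.1 hU
  refine ⟨initialWord δ n, ?_, ?_⟩ <;> rw [range_prependWord_initialWord]
  · exact (PiNat.isOpen_cylinder _ δ n).mem_nhds hε
  · exact hV

/-- A countable infinite closed set of binary sequences has exactly one accumulation point in some
neighbourhood of one of its accumulation points. -/
theorem exists_isolated_accPt {E : Set (ℕ → Fin 2)} (hE : IsClosed E) (hinf : E.Infinite)
    (hcount : E.Countable) :
    ∃ ε, AccPt ε (Filter.principal E) ∧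
      ∃ U ∈ nhds ε, ∀ δ ∈ U, AccPt δ (Filter.principal E) → δ = ε := by
  by_contra! h
  have hperf : Perfect (derivedSet E) := by
    refine ⟨isClosed_derivedSet E, fun ε hε => accPt_iff_nhds.2 fun U hU => ?_⟩
    obtain ⟨δ, hδU, hδ, hne⟩ := h ε hε U hU
    exact ⟨δ, ⟨hδU, hδ⟩, hne⟩
  let := TopologicalSpace.upgradeIsCompletelyMetrizable (ℕ → Fin 2)
  obtain ⟨f, hf, -, hinj⟩ := hperf.exists_nat_bool_injection hinf.exists_accPt_principal
  have hD : (derivedSet E).Countable :=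
    hcount.mono ((isClosed_iff_derivedSet_subset E).1 hE)
  have huniv : (univ : Set (ℕ → Bool)).Countable :=
    Set.countable_of_injective_of_countable_image hinj.injOn
      (hD.mono (by rw [image_univ]; exact hf))
  have hle := Cardinal.mk_le_aleph0_iff.2 (countable_univ_iff.1 huniv)
  rw [← Cardinal.power_def, Cardinal.mk_bool, Cardinal.mk_nat] at hle
  exact (Cardinal.cantor _).not_ge hle

theorem digit_cast_le_one (i : Fin 2) : ((i : ℕ) : ℝ) ≤ 1 := by
  exact_mod_cast Nat.lt_succ_iff.1 i.2

theorem digit_eq_zero_or_one (i : Fin 2) : i = 0 ∨ i = 1 := by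
  fin_cases i <;> simp

theorem hasSum_one_div_pow_succ {q : ℝ} (hq : 1 < q) :
    HasSum (fun i : ℕ => 1 / q ^ (i + 1)) (1 / (q - 1)) := by
  have hq0 : q ≠ 0 := by positivity
  have hq1 : q - 1 ≠ 0 := by linarith
  have h := (hasSum_geometric_of_lt_one (inv_nonneg.2 (by linarith))
    (inv_lt_one_of_one_lt₀ hq)).mul_left (1 / q)
  have hterm : (fun i : ℕ => 1 / q ^ (i + 1)) = fun i => 1 / q * q⁻¹ ^ i := by
    ext i
    rw [pow_succ, inv_pow]
    field_simp
  have hval : 1 / (q - 1) = 1 / q * (1 - q⁻¹)⁻¹ := by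
    rw [one_div, one_div, ← mul_inv]
    congr 1
    field_simp
  rwa [hterm, hval]

theorem digit_div_pow_nonneg {q : ℝ} (hq : 1 < q) (ε : ℕ → Fin 2) (i : ℕ) :
    0 ≤ ((ε i : ℕ) : ℝ) / q ^ (i + 1) := by
  positivity

theorem digit_div_pow_le {q : ℝ} (hq : 1 < q) (ε : ℕ → Fin 2) (i : ℕ) :
    ((ε i : ℕ) : ℝ) / q ^ (i + 1) ≤ 1 / q ^ (i + 1) := by
  have := digit_cast_le_one (ε i)
  gcongr

theorem summable_digit_div_pow {q : ℝ} (hq : 1 < q) (ε : ℕ → Fin 2) :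
    Summable fun i : ℕ => ((ε i : ℕ) : ℝ) / q ^ (i + 1) :=
  .of_nonneg_of_le (digit_div_pow_nonneg hq ε) (digit_div_pow_le hq ε)
    (hasSum_one_div_pow_succ hq).summable

theorem seqVal_mem_Iq {q : ℝ} (hq : 1 < q) (ε : ℕ → Fin 2) : seqVal q ε ∈ Iq q := by
  refine ⟨tsum_nonneg (digit_div_pow_nonneg hq ε), ?_⟩
  rw [← (hasSum_one_div_pow_succ hq).tsum_eq]
  exact (summable_digit_div_pow hq ε).tsum_le_tsum (digit_div_pow_le hq ε)
    (hasSum_one_div_pow_succ hq).summable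

theorem continuous_seqVal {q : ℝ} (hq : 1 < q) : Continuous (seqVal q) := by
  refine continuous_tsum (fun i => ?_) (hasSum_one_div_pow_succ hq).summable fun i ε => ?_
  · exact ((continuous_of_discreteTopology (f := fun d : Fin 2 => ((d : ℕ) : ℝ))).comp
      (continuous_apply i)).div_const _
  · rw [Real.norm_of_nonneg (digit_div_pow_nonneg hq ε i)]
    exact digit_div_pow_le hq ε i

theorem isClosed_SigmaSet {q : ℝ} (hq : 1 < q) (x : ℝ) : IsClosed (SigmaSet q x) :=
  isClosed_eq continuous_const (continuous_seqVal hq)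

theorem Tmap_seqVal {q : ℝ} (hq : 1 < q) (ε : ℕ → Fin 2) :
    Tmap q (ε 0) (seqVal q ε) = seqVal q fun n => ε (n + 1) := by
  have hq0 : q ≠ 0 := by positivity
  have h : seqVal q ε = ((ε 0 : ℕ) : ℝ) / q + (1 / q) * seqVal q fun n => ε (n + 1) := by
    rw [seqVal, (summable_digit_div_pow hq ε).tsum_eq_zero_add, seqVal, ← tsum_mul_left]
    congr 1
    · simp
    · refine tsum_congr fun i => ?_
      field_simp
      ring
  rw [Tmap, h]
  field_simp
  ring

theorem Tmap_injective {q : ℝ} (hq : 1 < q) (i : Fin 2) : Function.Injective (Tmap q i) := by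
  intro x y h
  have hq0 : q ≠ 0 := by positivity
  simpa [Tmap, hq0] using h

theorem prependWord_mem_SigmaSet_iff {q : ℝ} (hq : 1 < q) (a : List (Fin 2)) (x : ℝ)
    (ε : ℕ → Fin 2) : prependWord a ε ∈ SigmaSet q x ↔ ε ∈ SigmaSet q (wordMap q a x) := by
  induction a generalizing x with
  | nil => rfl
  | cons i a ih =>
    have hw : wordMap q (i :: a) x = wordMap q a (Tmap q i x) := rfl
    rw [hw, ← ih]
    change x = _ ↔ Tmap q i x = _
    rw [← (Tmap_injective hq i).eq_iff]
    exact Eq.congr_right (Tmap_seqVal hq (prependWord (i :: a) ε))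

theorem eq_const_of_seqVal_eq {q c : ℝ} {d : Fin 2}
    (hq : 1 < q) (hc : ∀ i, Tmap q i c ∈ Iq q → i = d) (hd : Tmap q d c = c) (ε : ℕ → Fin 2)
    (h : c = seqVal q ε) : ε = fun _ => d := by
  funext n
  have h0 : ∀ ε : ℕ → Fin 2, c = seqVal q ε → ε 0 = d := by
    intro ε h
    refine hc _ ?_
    rw [h, Tmap_seqVal hq]
    exact seqVal_mem_Iq hq _
  induction n generalizing ε with
  | zero => exact h0 ε h
  | succ n ih =>
    refine ih (fun n => ε (n + 1)) ?_
    rw [← Tmap_seqVal hq, h0 ε h, ← h, hd]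

theorem mem_Ioo_of_infinite_SigmaSet {q x : ℝ} (hq : 1 < q) (h : (SigmaSet q x).Infinite) :
    x ∈ Ioo 0 (1 / (q - 1)) := by
  have hmem : x ∈ Iq q := by
    obtain ⟨ε, hε⟩ := h.nonempty
    rw [show x = seqVal q ε from hε]
    exact seqVal_mem_Iq hq ε
  have hne : ∀ d : Fin 2, (∀ i, Tmap q i x ∈ Iq q → i = d) → Tmap q d x = x → False :=
    fun d hc hd => h ((finite_singleton fun _ => d).subset
      fun ε hε => eq_const_of_seqVal_eq hq hc hd ε hε)
  have hq1 : q - 1 ≠ 0 := by linarith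
  refine ⟨hmem.1.lt_of_ne fun hx => hne 0 (fun i hi => ?_) ?_,
    hmem.2.lt_of_ne fun hx => hne 1 (fun i hi => ?_) ?_⟩
  · subst hx
    rcases digit_eq_zero_or_one i with rfl | rfl
    · rfl
    · have := hi.1
      norm_num [Tmap] at this
  · simp [Tmap, ← hx]
  · rcases digit_eq_zero_or_one i with rfl | rfl
    · have h1 := hi.2
      have h2 : q * x = x + 1 := by rw [hx]; field_simp; ring
      simp only [Tmap, h2, ← hx] at h1
      norm_num at h1
    · rfl
  · rw [hx, Tmap]
    field_simp
    simp

theorem applySeq_succ (a : ℕ → ℝ → ℝ) (n : ℕ) (x : ℝ) :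
    applySeq a (n + 1) x = a n (applySeq a n x) := by
  simp [applySeq, List.range_succ]

theorem applySeq_Tmap_seqVal {q : ℝ} (hq : 1 < q) (ε : ℕ → Fin 2) (n : ℕ) :
    applySeq (fun k => Tmap q (ε k)) n (seqVal q ε) = seqVal q fun k => ε (k + n) := by
  induction n with
  | zero => rfl
  | succ n ih =>
    have h := Tmap_seqVal hq fun k => ε (k + n)
    rw [zero_add] at h
    rw [applySeq_succ, ih, h]
    simp only [add_right_comm, add_assoc]

theorem sum_range_digit_div_pow {q : ℝ} (hq : 1 < q) (ε : ℕ → Fin 2) (x : ℝ) (n : ℕ) :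
    ∑ i ∈ Finset.range n, ((ε i : ℕ) : ℝ) / q ^ (i + 1) =
      x - applySeq (fun k => Tmap q (ε k)) n x / q ^ n := by
  have hq0 : q ≠ 0 := by positivity
  induction n with
  | zero => simp [applySeq]
  | succ n ih =>
    rw [Finset.sum_range_succ, ih, applySeq_succ, Tmap]
    field_simp
    ring

theorem Tmap_comp_mem_OmegaSet_iff {q : ℝ} (hq : 1 < q) (x : ℝ) (ε : ℕ → Fin 2) :
    (fun k => Tmap q (ε k)) ∈ OmegaSet q x ↔ ε ∈ SigmaSet q x := by
  constructor
  · rintro ⟨-, h⟩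
    have hlim : Filter.Tendsto (fun n => applySeq (fun k => Tmap q (ε k)) (n + 1) x / q ^ (n + 1))
        Filter.atTop (nhds 0) := by
      have hbound : Filter.Tendsto (fun n : ℕ => 1 / (q - 1) / q ^ (n + 1))
          Filter.atTop (nhds 0) :=
        ((tendsto_pow_atTop_atTop_of_one_lt hq).comp
          (Filter.tendsto_add_atTop_nat 1)).const_div_atTop _
      refine squeeze_zero (fun n => div_nonneg (h n).1 (by positivity)) (fun n => ?_) hbound
      have := (h n).2
      gcongr
    have hsum := (Filter.tendsto_add_atTop_iff_nat 1).2
      (summable_digit_div_pow hq ε).hasSum.tendsto_sum_nat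
    simp only [sum_range_digit_div_pow hq ε x] at hsum
    have := tendsto_nhds_unique (hlim.const_sub x) hsum
    rwa [sub_zero] at this
  · intro h
    refine ⟨fun n => (digit_eq_zero_or_one (ε n)).imp (congrArg (Tmap q)) (congrArg (Tmap q)),
      fun n => ?_⟩
    rw [show x = seqVal q ε from h, applySeq_Tmap_seqVal hq]
    exact seqVal_mem_Iq hq _

theorem OmegaSet_eq_image {q : ℝ} (hq : 1 < q) (x : ℝ) :
    OmegaSet q x = (fun (ε : ℕ → Fin 2) k => Tmap q (ε k)) '' SigmaSet q x := by
  ext a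
  constructor
  · intro ha
    have : ∀ n, ∃ i, a n = Tmap q i := fun n => (ha.1 n).elim (⟨0, ·⟩) (⟨1, ·⟩)
    choose ε hε using this
    obtain rfl : a = fun k => Tmap q (ε k) := funext hε
    exact ⟨ε, (Tmap_comp_mem_OmegaSet_iff hq x ε).1 ha, rfl⟩
  · rintro ⟨ε, hε, rfl⟩
    exact (Tmap_comp_mem_OmegaSet_iff hq x ε).2 hε

theorem finite_OmegaSet_iff {q : ℝ} (hq : 1 < q) (x : ℝ) :
    (OmegaSet q x).Finite ↔ (SigmaSet q x).Finite := by
  rw [OmegaSet_eq_image hq]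
  refine finite_image_iff (Function.Injective.injOn fun ε δ h => funext fun n => ?_)
  have hn := congrFun (congrFun h n) 0
  exact Fin.ext (by simpa [Tmap] using hn)

/-- Infinitely many expansions of `wordMap q a x` accumulate, after prepending `a`, at an
accumulation point of the set of expansions of `x`. -/
theorem exists_accPt_SigmaSet {q x : ℝ} (hq : 1 < q) (a : List (Fin 2))
    (h : (SigmaSet q (wordMap q a x)).Infinite) :
    ∃ δ, AccPt (prependWord a δ) (Filter.principal (SigmaSet q x)) := by
  obtain ⟨δ, hδ⟩ := h.exists_accPt_principal
  refine ⟨δ, AccPt.mono (hδ.map (continuous_prependWord a).continuousAt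
    (prependWord_injective a)) ?_⟩
  rw [Filter.map_principal, Filter.principal_mono, image_subset_iff]
  exact fun ε hε => (prependWord_mem_SigmaSet_iff hq a x ε).2 hε

/-- If `q ∈ B_{ℵ₀}` then `(0, 1/(q-1))` contains a `q` null infinite point. -/
theorem BAleph0_has_null_infinite_point
    (q : ℝ) (hq : q ∈ BAleph0) :
    ∃ x ∈ Set.Ioo (0 : ℝ) (1 / (q - 1)), NullInfinite q x := by
  obtain ⟨⟨hq1, -⟩, x, -, hcard⟩ := hq
  have hcount : (SigmaSet q x).Countable := Cardinal.mk_le_aleph0_iff.1 hcard.le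
  have hinf : (SigmaSet q x).Infinite :=
    Set.infinite_coe_iff.1 (Cardinal.infinite_iff.2 hcard.ge)
  obtain ⟨ε, hε, U, hU, huniq⟩ := exists_isolated_accPt (isClosed_SigmaSet hq1 x) hinf hcount
  obtain ⟨w, hw, hwU⟩ := exists_range_prependWord_subset hU
  have hyinf : (SigmaSet q (wordMap q w x)).Infinite := by
    intro hfin
    refine (Set.Infinite.of_accPt (hε.nhds_inter hw)) ((hfin.image (prependWord w)).subset ?_)
    rintro _ ⟨⟨δ, rfl⟩, hδ⟩
    exact ⟨δ, (prependWord_mem_SigmaSet_iff hq1 w x δ).1 hδ, rfl⟩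
  have hy := mem_Ioo_of_infinite_SigmaSet hq1 hyinf
  refine ⟨wordMap q w x, hy, hy, fun h => hyinf ((finite_OmegaSet_iff hq1 _).1 h), fun a _ => ?_⟩
  by_contra! h
  have hacc : ∀ i : Fin 2, ∃ δ, prependWord (w ++ (a ++ [i])) δ = ε := by
    intro i
    have hword : Tmap q i (wordMap q a (wordMap q w x)) = wordMap q (w ++ (a ++ [i])) x := by
      simp [wordMap]
    have hi : (SigmaSet q (wordMap q (w ++ (a ++ [i])) x)).Infinite := by
      rw [← hword]
      exact fun hfin => h i ((finite_OmegaSet_iff hq1 _).2 hfin)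
    obtain ⟨δ, hδ⟩ := exists_accPt_SigmaSet hq1 _ hi
    exact ⟨δ, huniq _ (hwU (by rw [prependWord_append]; exact mem_range_self _)) hδ⟩
  obtain ⟨δ, hδ⟩ := hacc 0
  obtain ⟨δ', hδ'⟩ := hacc 1
  rw [← hδ'] at hδ
  simp only [prependWord_append] at hδ
  have := congrFun (prependWord_injective a (prependWord_injective w hδ)) 0
  exact zero_ne_one this
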